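/- arXiv:2406.06349 — 6 statements merged into one kernel-verified Lean document; each statement's English description precedes it below -/
import Mathlib

section
/- Let p, q ≥ 1, φ_1,…,φ_p, θ_1,…,θ_q ∈ ℝ and n ≥ p. Let X_1,…,X_n and ξ_{p-q+1},…,ξ_n be real random variables on a common probability space such that X_t + ∑_{i=1}^p φ_i X_{t-i} = ξ_t + ∑_{i=1}^q θ_i ξ_{t-i} holds almost surely for every t with p < t ≤ n. If the joint law of the random vector (X_1,…,X_p, ξ_{p-q+1},…,ξ_n) on ℝ^{n+q} is absolutely continuous with respect to Lebesgue measure, then the law of (X_1,…,X_n) on ℝ^n is absolutely continuous with respect to Lebesgue measure. -/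
open MeasureTheory

/-- A linear endomap of `ℝ^n` that is lower triangular with unit diagonal is bijective. -/
lemma LinearMap.bijective_of_unitriangular {n : ℕ} (T : (Fin n → ℝ) →ₗ[ℝ] Fin n → ℝ)
    (hT : ∀ x i, (∀ k < i, x k = 0) → T x i = x i) : Function.Bijective T := by
  have hinj : Function.Injective T := by
    refine (injective_iff_map_eq_zero T).2 fun x hx => funext fun i => ?_
    induction i using WellFoundedLT.induction with
    | ind i ih => rw [← hT x i ih, hx]
  exact ⟨hinj, LinearMap.injective_iff_surjective.1 hinj⟩

/-- A surjective linear map pushes absolutely continuous measures to absolutely continuous ones. -/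
lemma MeasureTheory.Measure.AbsolutelyContinuous.map_linearMap_of_surjective {m n : ℕ}
    {μ : Measure (Fin m → ℝ)} (hμ : μ ≪ volume) (L : (Fin m → ℝ) →ₗ[ℝ] Fin n → ℝ)
    (hL : Function.Surjective L) : μ.map L ≪ volume := by
  obtain ⟨c, -, -, hc⟩ := L.exists_map_addHaar_eq_smul_addHaar' volume volume hL
  refine (hμ.map L.continuous_of_finiteDimensional.measurable).trans ?_
  rw [hc]
  exact Measure.smul_absolutelyContinuous

/-- The autoregressive side of the ARMA recursion: the first `p` coordinates are kept, and each
later one is replaced by its combination with the `p` preceding coordinates. -/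
noncomputable def autoregressiveMap {p : ℕ} (n : ℕ) (φ : Fin p → ℝ) :
    (Fin n → ℝ) →ₗ[ℝ] Fin n → ℝ :=
  LinearMap.pi fun i => if (i : ℕ) < p then LinearMap.proj i else
    LinearMap.proj i + ∑ j : Fin p, φ j • LinearMap.proj (⟨i - 1 - j, by omega⟩ : Fin n)

/-- The moving-average side of the ARMA recursion, as a function of `p` initial values followed by
the noise: the initial values are kept, and the noise is replaced by its moving average. -/
noncomputable def movingAverageMap {q : ℕ} (p n : ℕ) (θ : Fin q → ℝ) :
    (Fin (n + q) → ℝ) →ₗ[ℝ] Fin n → ℝ :=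
  LinearMap.pi fun i => if (i : ℕ) < p then LinearMap.proj (i.castAdd q) else
    LinearMap.proj (i.addNat q) +
      ∑ j : Fin q, θ j • LinearMap.proj (⟨i + q - 1 - j, by omega⟩ : Fin (n + q))

lemma autoregressiveMap_apply {p : ℕ} (n : ℕ) (φ : Fin p → ℝ) (x : Fin n → ℝ) (i : Fin n) :
    autoregressiveMap n φ x i = if (i : ℕ) < p then x i else
      x i + ∑ j : Fin p, φ j * x ⟨i - 1 - j, by omega⟩ := by
  simp only [autoregressiveMap, LinearMap.pi_apply]
  split_ifs <;> simp

lemma movingAverageMap_apply {q : ℕ} (p n : ℕ) (θ : Fin q → ℝ) (z : Fin (n + q) → ℝ)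
    (i : Fin n) :
    movingAverageMap p n θ z i = if (i : ℕ) < p then z (i.castAdd q) else
      z (i.addNat q) + ∑ j : Fin q, θ j * z ⟨i + q - 1 - j, by omega⟩ := by
  simp only [movingAverageMap, LinearMap.pi_apply]
  split_ifs <;> simp

lemma autoregressiveMap_bijective {p : ℕ} (n : ℕ) (φ : Fin p → ℝ) :
    Function.Bijective (autoregressiveMap n φ) := by
  refine LinearMap.bijective_of_unitriangular _ fun x i hx => ?_
  rw [autoregressiveMap_apply]
  split_ifs with hi
  · rfl
  · rw [Finset.sum_eq_zero, add_zero]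
    intro j _
    rw [hx _ (Fin.lt_def.2 (by dsimp only; omega)), mul_zero]

lemma movingAverageMap_surjective {q : ℕ} (p n : ℕ) (θ : Fin q → ℝ) :
    Function.Surjective (movingAverageMap p n θ) := by
  let ι : (Fin n → ℝ) →ₗ[ℝ] Fin (n + q) → ℝ :=
    LinearMap.pi fun k => if h : (k : ℕ) < p ∧ (k : ℕ) < n then LinearMap.proj ⟨k, h.2⟩ else
      if h' : p + q ≤ k then LinearMap.proj (⟨k - q, by omega⟩ : Fin n) else 0
  have hι : ∀ x k, ι x k = if h : (k : ℕ) < p ∧ (k : ℕ) < n then x ⟨k, h.2⟩ else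
      if h' : p + q ≤ k then x ⟨k - q, by omega⟩ else 0 := by
    intro x k
    simp only [ι, LinearMap.pi_apply]
    split_ifs <;> simp
  refine Function.Surjective.of_comp (g := ι) ?_
  rw [← LinearMap.coe_comp]
  refine (LinearMap.bijective_of_unitriangular _ fun x i hx => ?_).2
  rw [LinearMap.comp_apply, movingAverageMap_apply]
  split_ifs with hi
  · simp [hι, hi]
  · rw [Finset.sum_eq_zero, add_zero, hι, dif_neg (by simp; omega), dif_pos (by simp; omega)]
    · simp
    · intro j _
      rw [hι, dif_neg (by dsimp only; omega)]
      split_ifs with h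
      · rw [hx _ (Fin.lt_def.2 (by dsimp only at h ⊢; omega)), mul_zero]
      · rw [mul_zero]

/-- If `(X_1, …, X_p, ξ_{p-q+1}, …, ξ_n)` has a Lebesgue-absolutely-continuous law
on `ℝ^{n+q}` and the ARMA recursion holds a.s. for `p < t ≤ n`, then the law of
`(X_1, …, X_n)` is absolutely continuous with respect to Lebesgue measure on `ℝ^n`. -/
theorem arma_truncation_absolutelyContinuous {Ω : Type*} [MeasurableSpace Ω]
    (P : Measure Ω) [IsProbabilityMeasure P]
    (p q n : ℕ) (hp : 1 ≤ p) (hq : 1 ≤ q) (hn : p ≤ n)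
    (φ : Fin p → ℝ) (θ : Fin q → ℝ)
    (X ξ : ℤ → Ω → ℝ) (hX : ∀ t, Measurable (X t)) (hξ : ∀ t, Measurable (ξ t))
    (harma : ∀ t : ℤ, (p : ℤ) < t → t ≤ (n : ℤ) →
      ∀ᵐ ω ∂P,
        X t ω + ∑ i : Fin p, φ i * X (t - ((i : ℤ) + 1)) ω =
          ξ t ω + ∑ i : Fin q, θ i * ξ (t - ((i : ℤ) + 1)) ω)
    (hjoint :
      Measure.map
        (fun ω => fun i : Fin (n + q) =>
          if h : (i : ℕ) < p then X ((i : ℕ) + 1 : ℤ) ω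
          else ξ ((p : ℤ) - (q : ℤ) + 1 + ((i : ℕ) - p : ℕ)) ω) P ≪
        (volume : Measure (Fin (n + q) → ℝ))) :
    Measure.map (fun ω => fun i : Fin n => X ((i : ℕ) + 1 : ℤ) ω) P ≪
      (volume : Measure (Fin n → ℝ)) := by
  let A := LinearEquiv.ofBijective _ (autoregressiveMap_bijective n φ)
  let L := A.symm.toLinearMap ∘ₗ movingAverageMap p n θ
  have hL : Function.Surjective L :=
    A.symm.surjective.comp (movingAverageMap_surjective p n θ)
  have hac := hjoint.map_linearMap_of_surjective L hL
  rw [Measure.map_map L.continuous_of_finiteDimensional.measurable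
    (measurable_pi_lambda _ fun i => by split_ifs <;> simp [hX, hξ])] at hac
  refine (Measure.map_congr ?_).le.absolutelyContinuous.trans hac
  have hall : ∀ᵐ ω ∂P, ∀ t : ℤ, (p : ℤ) < t → t ≤ (n : ℤ) →
      X t ω + ∑ i : Fin p, φ i * X (t - ((i : ℤ) + 1)) ω =
        ξ t ω + ∑ i : Fin q, θ i * ξ (t - ((i : ℤ) + 1)) ω := by
    simpa only [ae_all_iff] using harma
  filter_upwards [hall] with ω hω
  refine A.eq_symm_apply.2 (funext fun i => ?_)
  rw [LinearEquiv.ofBijective_apply, autoregressiveMap_apply, movingAverageMap_apply]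
  split_ifs with hi
  · simp [hi]
  · beta_reduce
    convert hω ((i : ℕ) + 1) (by omega) (by omega) using 2
    · refine Finset.sum_congr rfl fun j _ => ?_
      congr 2
      dsimp only
      omega
    · rw [dif_neg (by simp; omega)]
      congr 1
      simp only [Fin.val_addNat]
      omega
    · refine Finset.sum_congr rfl fun j _ => ?_
      rw [dif_neg (by dsimp only; omega)]
      congr 2
      dsimp only
      omega
end

section
/- Let X be a real random variable on a probability space and suppose its quantized entropy satisfies H_1(X) < m for some real m. Then there exists a constant C ∈ ℝ, depending only on the distribution of X and not on ε, such that for every ε ∈ (−1, 1), H_1(X + ε) ≤ 4m + C. -/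
open MeasureTheory

theorem Real.negMulLog_add_le {a b : ℝ} (ha : 0 ≤ a) (hb : 0 ≤ b) :
    Real.negMulLog (a + b) ≤ Real.negMulLog a + Real.negMulLog b := by
  have key : ∀ {x y : ℝ}, 0 ≤ x → 0 ≤ y → x * Real.log x ≤ x * Real.log (x + y) := by
    intro x y hx hy
    rcases hx.eq_or_lt with rfl | hx
    · simp
    · exact mul_le_mul_of_nonneg_left (Real.log_le_log hx (by linarith)) hx.le
  have h₁ := key ha hb
  have h₂ := key hb ha
  rw [add_comm b a] at h₂
  simp only [Real.negMulLog]
  linarith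

theorem Real.negMulLog_add_negMulLog_le {a b : ℝ} (ha : 0 ≤ a) (hb : 0 ≤ b) :
    Real.negMulLog a + Real.negMulLog b ≤ Real.negMulLog (a + b) + (a + b) * Real.log 2 := by
  rcases (add_nonneg ha hb).eq_or_lt with h | h
  · obtain rfl : a = 0 := by linarith
    obtain rfl : b = 0 := by linarith
    simp
  have hc := Real.concaveOn_negMulLog.2 (Set.mem_Ici.2 ha) (Set.mem_Ici.2 hb)
    (by norm_num : (0 : ℝ) ≤ 1 / 2) (by norm_num : (0 : ℝ) ≤ 1 / 2) (by norm_num)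
  have he : (1 / 2 : ℝ) * a + 1 / 2 * b = (a + b) / 2 := by ring
  simp only [smul_eq_mul, he] at hc
  have hl : Real.negMulLog ((a + b) / 2)
      = (Real.negMulLog (a + b) + (a + b) * Real.log 2) / 2 := by
    simp only [Real.negMulLog]
    rw [Real.log_div h.ne' two_ne_zero]
    ring
  linarith

theorem hasSum_measureReal_fiber {Ω : Type*} [MeasurableSpace Ω] (P : Measure Ω)
    [IsProbabilityMeasure P] {Y : Ω → ℤ} (hY : Measurable Y) :
    HasSum (fun i : ℤ => P.real {ω | Y ω = i}) 1 := by
  have hd : Pairwise (Function.onFun Disjoint fun i : ℤ => {ω | Y ω = i}) := by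
    intro i j hij
    exact Set.disjoint_left.2 fun ω h₁ h₂ => hij (h₁.symm.trans h₂)
  have hm : ∀ i : ℤ, MeasurableSet {ω | Y ω = i} := fun i => hY (measurableSet_singleton i)
  have hu : ∑' i : ℤ, P {ω | Y ω = i} = 1 := by
    rw [← measure_iUnion hd hm]
    convert measure_univ (μ := P)
    ext ω
    simp
  have h := ENNReal.hasSum_toReal (f := fun i : ℤ => P {ω | Y ω = i}) (by simp [hu])
  rwa [← ENNReal.tsum_toReal_eq (fun i => measure_ne_top P _), hu, ENNReal.toReal_one] at h

theorem tsum_negMulLog_add_shift_le {a b : ℤ → ℝ} (ha : ∀ i, 0 ≤ a i) (hb : ∀ i, 0 ≤ b i)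
    (hab : HasSum (fun i => a i + b i) 1) (s : ℤ)
    (hsum : Summable fun i => Real.negMulLog (a i + b i)) :
    (Summable fun i => Real.negMulLog (a i + b (i - s))) ∧
      ∑' i, Real.negMulLog (a i + b (i - s))
        ≤ ∑' i, Real.negMulLog (a i + b i) + Real.log 2 := by
  have hle_one : ∀ i, a i + b i ≤ 1 := fun i =>
    le_hasSum hab i fun j _ => add_nonneg (ha j) (hb j)
  have hηa : ∀ i, 0 ≤ Real.negMulLog (a i) := fun i =>
    Real.negMulLog_nonneg (ha i) (by linarith [hle_one i, hb i])
  have hηb : ∀ i, 0 ≤ Real.negMulLog (b i) := fun i =>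
    Real.negMulLog_nonneg (hb i) (by linarith [hle_one i, ha i])
  have hle : ∀ i, Real.negMulLog (a i) + Real.negMulLog (b i)
      ≤ Real.negMulLog (a i + b i) + (a i + b i) * Real.log 2 := fun i =>
    Real.negMulLog_add_negMulLog_le (ha i) (hb i)
  have hbound := hsum.hasSum.add (hab.mul_right (Real.log 2))
  rw [one_mul] at hbound
  have hsa : Summable fun i => Real.negMulLog (a i) :=
    hbound.summable.of_nonneg_of_le hηa fun i => by linarith [hle i, hηb i]
  have hsb : Summable fun i => Real.negMulLog (b i) :=
    hbound.summable.of_nonneg_of_le hηb fun i => by linarith [hle i, hηa i]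
  have hshift : HasSum (fun i => Real.negMulLog (b (i - s))) (∑' i, Real.negMulLog (b i)) :=
    (Equiv.subRight s).hasSum_iff (f := fun i => Real.negMulLog (b i)).2 hsb.hasSum
  have hupper := hsa.hasSum.add hshift
  have hqle : ∀ i, Real.negMulLog (a i + b (i - s))
      ≤ Real.negMulLog (a i) + Real.negMulLog (b (i - s)) := fun i =>
    Real.negMulLog_add_le (ha i) (hb _)
  have hlower : ∀ i, -((a i + b (i - s)) * Real.log 2)
      ≤ Real.negMulLog (a i + b (i - s)) := fun i => by
    linarith [Real.negMulLog_add_negMulLog_le (ha i) (hb (i - s)), hηa i, hηb (i - s)]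
  have hsuma : Summable a := hab.summable.of_nonneg_of_le ha fun i => by linarith [hb i]
  have hsumb : Summable b := hab.summable.of_nonneg_of_le hb fun i => by linarith [ha i]
  have hsumq : Summable fun i => (a i + b (i - s)) * Real.log 2 :=
    (hsuma.add ((Equiv.subRight s).summable_iff (f := b).2 hsumb)).mul_right _
  have hsq : Summable fun i => Real.negMulLog (a i + b (i - s)) := by
    have h := (hupper.summable.add hsumq).of_nonneg_of_le
      (g := fun i => Real.negMulLog (a i + b (i - s)) + (a i + b (i - s)) * Real.log 2)
      (fun i => by linarith [hlower i]) (fun i => by linarith [hqle i])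
    exact (h.sub hsumq).congr fun i => by ring
  exact ⟨hsq, (hasSum_le hqle hsq.hasSum hupper).trans
    (hasSum_le hle (hsa.hasSum.add hsb.hasSum) hbound)⟩

/-- If an integer variable `Z` is always `Y` or `Y + s`, its entropy exceeds that of `Y` by at
most `log 2`. -/
theorem entropy_le_of_eq_or_eq_add {Ω : Type*} [MeasurableSpace Ω] (P : Measure Ω)
    [IsProbabilityMeasure P] {Y Z : Ω → ℤ} (hY : Measurable Y) (hZ : Measurable Z) {s : ℤ}
    (hs : s ≠ 0) (hYZ : ∀ ω, Z ω = Y ω ∨ Z ω = Y ω + s)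
    (hsum : Summable fun i : ℤ => Real.negMulLog (P.real {ω | Y ω = i})) :
    (Summable fun i : ℤ => Real.negMulLog (P.real {ω | Z ω = i})) ∧
      ∑' i : ℤ, Real.negMulLog (P.real {ω | Z ω = i})
        ≤ ∑' i : ℤ, Real.negMulLog (P.real {ω | Y ω = i}) + Real.log 2 := by
  have hmeas : ∀ i j, MeasurableSet {ω | Y ω = i ∧ Z ω = j} := fun i j =>
    (hY (measurableSet_singleton i)).inter (hZ (measurableSet_singleton j))
  have hp : ∀ i, P.real {ω | Y ω = i}
      = P.real {ω | Y ω = i ∧ Z ω = i} + P.real {ω | Y ω = i ∧ Z ω = i + s} := by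
    intro i
    rw [← measureReal_union _ (hmeas _ _)]
    · congr 1
      ext ω
      have := hYZ ω
      simp only [Set.mem_ofPred_eq, Set.mem_union]
      lia
    · refine Set.disjoint_left.2 fun ω h₁ h₂ => ?_
      simp only [Set.mem_ofPred_eq] at h₁ h₂
      lia
  have hq : ∀ i, P.real {ω | Z ω = i}
      = P.real {ω | Y ω = i ∧ Z ω = i} + P.real {ω | Y ω = i - s ∧ Z ω = i - s + s} := by
    intro i
    rw [← measureReal_union _ (hmeas _ _)]
    · congr 1
      ext ω
      have := hYZ ω
      simp only [Set.mem_ofPred_eq, Set.mem_union]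
      lia
    · refine Set.disjoint_left.2 fun ω h₁ h₂ => ?_
      simp only [Set.mem_ofPred_eq] at h₁ h₂
      lia
  have hone := hasSum_measureReal_fiber P hY
  simp only [hp] at hsum hone
  simp only [hp, hq]
  exact tsum_negMulLog_add_shift_le (a := fun i => P.real {ω | Y ω = i ∧ Z ω = i})
    (b := fun i => P.real {ω | Y ω = i ∧ Z ω = i + s})
    (fun i => measureReal_nonneg) (fun i => measureReal_nonneg) hone s hsum

/-- If the quantized entropy of `X` satisfies `H_1(X) < m`, then there is a constant
`C` depending only on the distribution of `X` (not on `ε`) such that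
`H_1(X + ε) ≤ 4 m + C` for every `ε ∈ (-1, 1)`. -/
theorem quantized_entropy_shift_bound {Ω : Type*} [MeasurableSpace Ω]
    (P : Measure Ω) [IsProbabilityMeasure P] (X : Ω → ℝ) (hX : Measurable X) (m : ℝ)
    (hsum : Summable fun i : ℤ => Real.negMulLog ((P {ω | ⌊X ω⌋ = i}).toReal))
    (hm : ∑' i : ℤ, Real.negMulLog ((P {ω | ⌊X ω⌋ = i}).toReal) < m) :
    ∃ C : ℝ, ∀ ε : ℝ, ε ∈ Set.Ioo (-1 : ℝ) 1 →
      (Summable fun i : ℤ => Real.negMulLog ((P {ω | ⌊X ω + ε⌋ = i}).toReal)) ∧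
        ∑' i : ℤ, Real.negMulLog ((P {ω | ⌊X ω + ε⌋ = i}).toReal) ≤ 4 * m + C := by
  have h0 : 0 ≤ ∑' i : ℤ, Real.negMulLog ((P {ω | ⌊X ω⌋ = i}).toReal) := tsum_nonneg fun i =>
    Real.negMulLog_nonneg measureReal_nonneg measureReal_le_one
  refine ⟨Real.log 2, fun ε ⟨hε₁, hε₂⟩ => ?_⟩
  have hY : Measurable fun ω => ⌊X ω⌋ := hX.floor
  have hZ : Measurable fun ω => ⌊X ω + ε⌋ := (hX.add_const ε).floor
  obtain ⟨s, hs, hYZ⟩ : ∃ s : ℤ, s ≠ 0 ∧ ∀ ω, ⌊X ω + ε⌋ = ⌊X ω⌋ ∨ ⌊X ω + ε⌋ = ⌊X ω⌋ + s := by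
    rcases le_or_gt 0 ε with h | h
    · refine ⟨1, by simp, fun ω => ?_⟩
      have h₁ : ⌊X ω⌋ ≤ ⌊X ω + ε⌋ := Int.floor_le_floor (by linarith)
      have h₂ : ⌊X ω + ε⌋ ≤ ⌊X ω + 1⌋ := Int.floor_le_floor (by linarith)
      rw [Int.floor_add_one] at h₂
      lia
    · refine ⟨-1, by simp, fun ω => ?_⟩
      have h₁ : ⌊X ω + ε⌋ ≤ ⌊X ω⌋ := Int.floor_le_floor (by linarith)
      have h₂ : ⌊X ω - 1⌋ ≤ ⌊X ω + ε⌋ := Int.floor_le_floor (by linarith)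
      rw [Int.floor_sub_one] at h₂
      lia
  obtain ⟨h₁, h₂⟩ := entropy_le_of_eq_or_eq_add P hY hZ hs hYZ hsum
  exact ⟨h₁, h₂.trans (by simp only [measureReal_def]; linarith)⟩
end

section
/- Let X be a real random variable with quantized entropy H_1(X) ≤ m < ∞. Then there exists a constant C ∈ ℝ, depending only on the distribution of X, such that for every c ∈ ℝ and every integer k ≥ 1, the entropy of the integer-valued random variable ⌊k(X + c)⌋ satisfies ∑'_{i∈ℤ} negMulLog(P(⌊k(X + c)⌋ = i)) ≤ 4m + C + log k. -/
open MeasureTheory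

namespace QuantizedEntropy

/-- The measure of a set is the sum of the measures of its pieces along the fibres of a
measurable function with countable codomain. -/
theorem measure_eq_tsum_inter_fiber {Ω ι : Type*} [MeasurableSpace Ω] [MeasurableSpace ι]
    [Countable ι] [MeasurableSingletonClass ι] (P : Measure Ω) {N : Ω → ι} (hN : Measurable N)
    {A : Set Ω} (hA : MeasurableSet A) :
    P A = ∑' j, P (A ∩ {ω | N ω = j}) := by
  rw [← measure_iUnion]
  · congr 1
    ext ω
    simp
  · intro i j hij
    rw [Function.onFun, Set.disjoint_left]
    rintro ω ⟨_, hi⟩ ⟨_, hj⟩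
    exact hij (hi.symm.trans hj)
  · exact fun j => hA.inter (hN (measurableSet_singleton j))

theorem mul_neg_log_le_negMulLog {p q : ℝ} (hp : 0 ≤ p) (hpq : p ≤ q) :
    p * -Real.log q ≤ Real.negMulLog p := by
  rcases hp.eq_or_lt with rfl | hp
  · simp
  · rw [Real.negMulLog, neg_mul_comm]
    gcongr

/-- Countable subadditivity of `negMulLog` along the fibres of a measurable function. -/
theorem ofReal_negMulLog_measure_le_tsum {Ω ι : Type*} [MeasurableSpace Ω] [MeasurableSpace ι]
    [Countable ι] [MeasurableSingletonClass ι] (P : Measure Ω) [IsProbabilityMeasure P]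
    {N : Ω → ι} (hN : Measurable N) {A : Set Ω} (hA : MeasurableSet A) :
    ENNReal.ofReal (Real.negMulLog (P A).toReal) ≤
      ∑' j, ENNReal.ofReal (Real.negMulLog (P (A ∩ {ω | N ω = j})).toReal) := by
  have hsplit : ENNReal.ofReal (Real.negMulLog (P A).toReal) =
      P A * ENNReal.ofReal (-Real.log (P A).toReal) := by
    rw [Real.negMulLog, neg_mul_comm, ENNReal.ofReal_mul ENNReal.toReal_nonneg,
      ENNReal.ofReal_toReal (measure_ne_top P A)]
  rw [hsplit]
  nth_rewrite 1 [measure_eq_tsum_inter_fiber P hN hA]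
  rw [← ENNReal.tsum_mul_right]
  refine ENNReal.tsum_le_tsum fun j => ?_
  rw [← ENNReal.ofReal_toReal (measure_ne_top P (A ∩ {ω | N ω = j})),
    ← ENNReal.ofReal_mul ENNReal.toReal_nonneg]
  simp only [ENNReal.toReal_ofReal ENNReal.toReal_nonneg]
  exact ENNReal.ofReal_le_ofReal (mul_neg_log_le_negMulLog ENNReal.toReal_nonneg
    (ENNReal.toReal_mono (measure_ne_top P A) (measure_mono Set.inter_subset_left)))

/-- Among finite families with a given sum, the uniform one maximizes the entropy. -/
theorem sum_negMulLog_le {ι : Type*} {s : Finset ι} (hs : s.Nonempty) {p : ι → ℝ}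
    (hp : ∀ i ∈ s, 0 ≤ p i) :
    ∑ i ∈ s, Real.negMulLog (p i) ≤
      Real.negMulLog (∑ i ∈ s, p i) + (∑ i ∈ s, p i) * Real.log s.card := by
  have hn : (0 : ℝ) < s.card := by exact_mod_cast hs.card_pos
  have h := Real.concaveOn_negMulLog.le_map_sum (t := s) (w := fun _ => (s.card : ℝ)⁻¹) (p := p)
    (fun _ _ => by positivity) (by simp [hn.ne']) hp
  simp only [smul_eq_mul, ← Finset.mul_sum] at h
  rw [Real.negMulLog_mul, Real.negMulLog, Real.log_inv] at h
  have h' := mul_le_mul_of_nonneg_left h hn.le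
  field_simp at h'
  linarith

/-- If `Y` takes at most `n` values on each fibre of `N`, then `H(Y) ≤ H(N) + log n`. -/
theorem tsum_negMulLog_le_add_log {Ω ι κ : Type*} [MeasurableSpace Ω]
    [MeasurableSpace ι] [Countable ι] [MeasurableSingletonClass ι]
    [MeasurableSpace κ] [Countable κ] [MeasurableSingletonClass κ]
    (P : Measure Ω) [IsProbabilityMeasure P] {N : Ω → ι} (hN : Measurable N)
    {Y : Ω → κ} (hY : Measurable Y) (S : ι → Finset κ) {n : ℕ} (hn : 0 < n)
    (hS : ∀ j, (S j).card = n) (hYS : ∀ ω, Y ω ∈ S (N ω)) :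
    ∑' i, ENNReal.ofReal (Real.negMulLog (P {ω | Y ω = i}).toReal) ≤
      ∑' j, ENNReal.ofReal (Real.negMulLog (P {ω | N ω = j}).toReal) +
        ENNReal.ofReal (Real.log n) := by
  have hmN (j : ι) : MeasurableSet {ω | N ω = j} := hN (measurableSet_singleton j)
  have hmY (i : κ) : MeasurableSet {ω | Y ω = i} := hY (measurableSet_singleton i)
  have hzero (j : ι) (i : κ) (hi : i ∉ S j) : P ({ω | Y ω = i} ∩ {ω | N ω = j}) = 0 := by
    have : {ω | Y ω = i} ∩ {ω | N ω = j} = ∅ := by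
      rw [Set.eq_empty_iff_forall_notMem]
      rintro ω ⟨rfl, rfl⟩
      exact hi (hYS ω)
    rw [this, measure_empty]
  have hsum (j : ι) : ∑ i ∈ S j, (P ({ω | Y ω = i} ∩ {ω | N ω = j})).toReal =
      (P {ω | N ω = j}).toReal := by
    rw [← ENNReal.toReal_sum fun _ _ => measure_ne_top P _,
      measure_eq_tsum_inter_fiber P hY (hmN j), tsum_eq_sum (s := S j)]
    · simp only [Set.inter_comm]
    · intro i hi
      rw [Set.inter_comm]
      exact hzero j i hi
  have hnonneg (A : Set Ω) : 0 ≤ Real.negMulLog (P A).toReal :=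
    Real.negMulLog_nonneg ENNReal.toReal_nonneg
      (ENNReal.toReal_le_of_le_ofReal zero_le_one (by simpa using prob_le_one))
  have hlog : 0 ≤ Real.log n := Real.log_natCast_nonneg n
  calc ∑' i, ENNReal.ofReal (Real.negMulLog (P {ω | Y ω = i}).toReal)
      ≤ ∑' i, ∑' j, ENNReal.ofReal
          (Real.negMulLog (P ({ω | Y ω = i} ∩ {ω | N ω = j})).toReal) :=
        ENNReal.tsum_le_tsum fun i => ofReal_negMulLog_measure_le_tsum P hN (hmY i)
    _ = ∑' j, ∑' i, ENNReal.ofReal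
          (Real.negMulLog (P ({ω | Y ω = i} ∩ {ω | N ω = j})).toReal) := ENNReal.tsum_comm
    _ ≤ ∑' j, (ENNReal.ofReal (Real.negMulLog (P {ω | N ω = j}).toReal) +
          P {ω | N ω = j} * ENNReal.ofReal (Real.log n)) := by
        refine ENNReal.tsum_le_tsum fun j => ?_
        rw [tsum_eq_sum (s := S j) fun i hi => by simp [hzero j i hi],
          ← ENNReal.ofReal_sum_of_nonneg fun _ _ => hnonneg _]
        nth_rewrite 2 [← ENNReal.ofReal_toReal (measure_ne_top P {ω | N ω = j})]
        rw [← ENNReal.ofReal_mul ENNReal.toReal_nonneg, ← ENNReal.ofReal_add (hnonneg _)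
          (mul_nonneg ENNReal.toReal_nonneg hlog)]
        refine ENNReal.ofReal_le_ofReal ?_
        have h := sum_negMulLog_le (s := S j) (Finset.card_pos.1 (by rw [hS]; exact hn))
          (p := fun i => (P ({ω | Y ω = i} ∩ {ω | N ω = j})).toReal)
          fun _ _ => ENNReal.toReal_nonneg
        rwa [hsum, hS] at h
    _ = _ := by
        have htotal := measure_eq_tsum_inter_fiber P hN MeasurableSet.univ
        simp only [measure_univ, Set.univ_inter] at htotal
        rw [ENNReal.tsum_add, ENNReal.tsum_mul_right, ← htotal, one_mul]

theorem floor_mul_add_mem_Icc (x c : ℝ) (k : ℕ) :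
    ⌊(k : ℝ) * (x + c)⌋ ∈
      Finset.Icc ⌊(k : ℝ) * (⌊x⌋ + c)⌋ (⌊(k : ℝ) * (⌊x⌋ + c)⌋ + k) := by
  rw [Finset.mem_Icc]
  constructor
  · gcongr
    exact Int.floor_le x
  · rw [← Int.floor_add_natCast]
    refine Int.floor_le_floor ?_
    have := mul_le_mul_of_nonneg_left (Int.lt_floor_add_one x).le (Nat.cast_nonneg (α := ℝ) k)
    linarith

end QuantizedEntropy

/-- If `H_1(X) ≤ m < ∞`, then there is a constant `C` depending only on the
distribution of `X` such that for every shift `c ∈ ℝ` and every integer `k ≥ 1`,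
the entropy of `⌊k (X + c)⌋` is at most `4 m + C + log k`. -/
theorem quantized_entropy_shift_scale_bound {Ω : Type*} [MeasurableSpace Ω]
    (P : Measure Ω) [IsProbabilityMeasure P] (X : Ω → ℝ) (hX : Measurable X) (m : ℝ)
    (hsum : Summable fun i : ℤ => Real.negMulLog ((P {ω | ⌊X ω⌋ = i}).toReal))
    (hm : ∑' i : ℤ, Real.negMulLog ((P {ω | ⌊X ω⌋ = i}).toReal) ≤ m) :
    ∃ C : ℝ, ∀ c : ℝ, ∀ k : ℕ, 1 ≤ k →
      (Summable fun i : ℤ =>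
          Real.negMulLog ((P {ω | ⌊(k : ℝ) * (X ω + c)⌋ = i}).toReal)) ∧
        ∑' i : ℤ, Real.negMulLog ((P {ω | ⌊(k : ℝ) * (X ω + c)⌋ = i}).toReal) ≤
          4 * m + C + Real.log k := by
  have hnonneg (A : Set Ω) : 0 ≤ Real.negMulLog (P A).toReal :=
    Real.negMulLog_nonneg ENNReal.toReal_nonneg
      (ENNReal.toReal_le_of_le_ofReal zero_le_one (by simpa using prob_le_one))
  have hH : 0 ≤ ∑' i : ℤ, Real.negMulLog ((P {ω | ⌊X ω⌋ = i}).toReal) :=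
    tsum_nonneg fun i => hnonneg _
  refine ⟨Real.log 2, fun c k hk => ?_⟩
  have hlog : Real.log ((k + 1 : ℕ) : ℝ) ≤ Real.log 2 + Real.log k := by
    have hk' : (1 : ℝ) ≤ k := by exact_mod_cast hk
    rw [← Real.log_mul two_ne_zero (by positivity)]
    refine Real.log_le_log (by positivity) ?_
    push_cast
    linarith
  have hbound := QuantizedEntropy.tsum_negMulLog_le_add_log P
    (N := fun ω => ⌊X ω⌋) (Y := fun ω => ⌊(k : ℝ) * (X ω + c)⌋)
    hX.floor ((hX.add_const c).const_mul (k : ℝ)).floor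
    (fun j => Finset.Icc ⌊(k : ℝ) * (j + c)⌋ (⌊(k : ℝ) * (j + c)⌋ + k)) (n := k + 1)
    k.succ_pos (fun j => by rw [Int.card_Icc]; omega)
    (fun ω => QuantizedEntropy.floor_mul_add_mem_Icc (X ω) c k)
  rw [← ENNReal.ofReal_tsum_of_nonneg (fun _ => hnonneg _) hsum,
    ← ENNReal.ofReal_add hH (Real.log_natCast_nonneg _)] at hbound
  have hsummable : Summable fun i : ℤ =>
      Real.negMulLog ((P {ω | ⌊(k : ℝ) * (X ω + c)⌋ = i}).toReal) := by
    refine (ENNReal.summable_toReal (ne_top_of_le_ne_top ENNReal.ofReal_ne_top hbound)).congr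
      fun i => ?_
    exact ENNReal.toReal_ofReal (hnonneg _)
  refine ⟨hsummable, ?_⟩
  rw [← ENNReal.ofReal_tsum_of_nonneg (fun _ => hnonneg _) hsummable,
    ENNReal.ofReal_le_ofReal_iff (add_nonneg hH (Real.log_natCast_nonneg _))] at hbound
  linarith
end

section
/- Let Z be a real random variable with finite quantized entropy H_1(Z) < ∞ and let k ≥ 1 be an integer. Then the entropy of ⌊kZ⌋ satisfies ∑'_{i∈ℤ} negMulLog(P(⌊kZ⌋ = i)) ≤ H_1(Z) + log k. -/
open MeasureTheory

/-- The entropy of a finite family of masses with sum `s` is at most the entropy of `s` plus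
`s` times the logarithm of the number of masses. -/
theorem sum_negMulLog_le_negMulLog_sum_add {ι : Type*} [Fintype ι] [Nonempty ι] (a : ι → ℝ)
    (ha : ∀ i, 0 ≤ a i) :
    ∑ i, Real.negMulLog (a i) ≤
      Real.negMulLog (∑ i, a i) + (∑ i, a i) * Real.log (Fintype.card ι) := by
  have hc : (0 : ℝ) < Fintype.card ι := by exact_mod_cast Fintype.card_pos
  have hJensen := Real.concaveOn_negMulLog.le_map_sum (t := Finset.univ)
    (w := fun _ : ι => (Fintype.card ι : ℝ)⁻¹) (p := a) (fun _ _ => by positivity)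
    (by simp [hc.ne']) (fun i _ => ha i)
  simp only [smul_eq_mul, ← Finset.mul_sum] at hJensen
  rw [inv_mul_le_iff₀ hc, Real.negMulLog_mul] at hJensen
  refine hJensen.trans_eq ?_
  simp only [Real.negMulLog, Real.log_inv]
  field_simp
  ring

/-- The point masses of a countably valued random variable sum to one. -/
theorem hasSum_toReal_measure_fiber {Ω α : Type*} [MeasurableSpace Ω] [Countable α]
    [MeasurableSpace α] [MeasurableSingletonClass α] (P : Measure Ω) [IsProbabilityMeasure P]
    (X : Ω → α) (hX : Measurable X) :
    HasSum (fun i => (P {ω | X ω = i}).toReal) 1 := by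
  have hmeas (i : α) : MeasurableSet {ω | X ω = i} := hX (measurableSet_singleton i)
  have hsum : ∑' i, P {ω | X ω = i} = 1 := by
    rw [← measure_iUnion (fun i j hij => Set.disjoint_left.2 fun ω hi hj => hij (hi.symm.trans hj))
      hmeas]
    convert! measure_univ (μ := P)
    ext ω
    simp
  have h := ENNReal.hasSum_toReal (f := fun i => P {ω | X ω = i}) (by simp [hsum])
  rwa [← ENNReal.tsum_toReal_eq (fun i => measure_ne_top _ _), hsum, ENNReal.toReal_one] at h

/-- The event `⌊Z⌋ = i` splits into the `k` events `⌊kZ⌋ = k * i + r` with `0 ≤ r < k`. -/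
theorem sum_toReal_measure_floor_mul_eq {Ω : Type*} [MeasurableSpace Ω] (P : Measure Ω)
    [IsProbabilityMeasure P] (Z : Ω → ℝ) (hZ : Measurable Z) (k : ℕ) [NeZero k] (i : ℤ) :
    ∑ r : Fin k, (P {ω | ⌊(k : ℝ) * Z ω⌋ = (Int.divModEquiv k).symm (i, r)}).toReal =
      (P {ω | ⌊Z ω⌋ = i}).toReal := by
  have hmeas (j : ℤ) : MeasurableSet {ω | ⌊(k : ℝ) * Z ω⌋ = j} :=
    (hZ.const_mul (k : ℝ)).floor (measurableSet_singleton j)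
  rw [← ENNReal.toReal_sum (fun r _ => measure_ne_top _ _), ← tsum_fintype (L := .unconditional _),
    ← measure_iUnion _ fun r => hmeas _]
  · congr 2
    ext ω
    simp only [Set.mem_iUnion, Set.mem_ofPred_eq, Equiv.eq_symm_apply, Prod.ext_iff]
    simp [Int.natCast_mul_floor_div_cancel (NeZero.ne k)]
  · refine fun r s hrs => Set.disjoint_left.2 fun ω hr hs => hrs ?_
    simpa [Fin.ext_iff] using hr.symm.trans hs

/-- If `Z` has finite quantized entropy `H_1(Z)` and `k ≥ 1`, then the entropy of
`⌊kZ⌋` is at most `H_1(Z) + log k`. -/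
theorem entropy_floor_scaled_le {Ω : Type*} [MeasurableSpace Ω]
    (P : Measure Ω) [IsProbabilityMeasure P] (Z : Ω → ℝ) (hZ : Measurable Z)
    (hfin : Summable fun i : ℤ => Real.negMulLog ((P {ω | ⌊Z ω⌋ = i}).toReal))
    (k : ℕ) (hk : 1 ≤ k) :
    (Summable fun i : ℤ => Real.negMulLog ((P {ω | ⌊(k : ℝ) * Z ω⌋ = i}).toReal)) ∧
      ∑' i : ℤ, Real.negMulLog ((P {ω | ⌊(k : ℝ) * Z ω⌋ = i}).toReal) ≤
        (∑' i : ℤ, Real.negMulLog ((P {ω | ⌊Z ω⌋ = i}).toReal)) + Real.log k := by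
  have : NeZero k := ⟨by omega⟩
  set p : ℤ → ℝ := fun j => (P {ω | ⌊(k : ℝ) * Z ω⌋ = j}).toReal
  set q : ℤ → ℝ := fun i => (P {ω | ⌊Z ω⌋ = i}).toReal
  let e := (Int.divModEquiv k).symm
  have hp0 (j : ℤ) : 0 ≤ Real.negMulLog (p j) :=
    Real.negMulLog_nonneg ENNReal.toReal_nonneg measureReal_le_one
  have hle (i : ℤ) : ∑ r : Fin k, Real.negMulLog (p (e (i, r))) ≤
      Real.negMulLog (q i) + q i * Real.log k := by
    have h := sum_negMulLog_le_negMulLog_sum_add (fun r : Fin k => p (e (i, r)))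
      fun _ => ENNReal.toReal_nonneg
    rwa [sum_toReal_measure_floor_mul_eq P Z hZ k i, Fintype.card_fin] at h
  have hbound := hfin.hasSum.add
    ((hasSum_toReal_measure_fiber P (fun ω => ⌊Z ω⌋) hZ.floor).mul_right (Real.log k))
  rw [one_mul] at hbound
  have hrow : Summable fun i : ℤ => ∑ r : Fin k, Real.negMulLog (p (e (i, r))) :=
    .of_nonneg_of_le (fun i => Finset.sum_nonneg fun r _ => hp0 _) hle hbound.summable
  have hprod : Summable fun x : ℤ × Fin k => Real.negMulLog (p (e x)) :=
    (summable_prod_of_nonneg fun x => hp0 _).2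
      ⟨fun i => (hasSum_fintype _).summable, by simpa only [tsum_fintype] using hrow⟩
  refine ⟨e.summable_iff.1 hprod, ?_⟩
  rw [← e.tsum_eq (fun j => Real.negMulLog (p j)), hprod.tsum_prod, ← hbound.tsum_eq]
  simp only [tsum_fintype]
  exact hrow.tsum_le_tsum hle hbound.summable
end

section
/- Let Z be a random vector in ℝ^d whose law is a countable mixture ∑_{i∈ℕ} w_i·(f_i)_*ν_i, where w_i ≥ 0 with ∑ w_i = 1, each f_i : ℝ^{d_i} → ℝ^d is an injective affine map, and each ν_i is a probability measure on ℝ^{d_i} absolutely continuous with respect to Lebesgue measure. Then for every linear map T : ℝ^d → ℝ^n, the law of T(Z) is a countable mixture ∑_{i∈ℕ} w_i·(g_i)_*ρ_i where each g_i : ℝ^{r_i} → ℝ^n is an injective affine map, each ρ_i is a probability measure on ℝ^{r_i} absolutely continuous with respect to Lebesgue measure, and r_i equals the rank of the composition of T with the linear part of f_i. In other words, a linear image of an affinely singular random vector is affinely singular, with singular dimensions given by the ranks of the restricted maps. -/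
open MeasureTheory
open scoped ENNReal

/-- A surjective linear map between finite-dimensional coordinate spaces pulls Lebesgue null sets
back to Lebesgue null sets. -/
lemma LinearMap.absolutelyContinuous_map_volume_of_surjective {m r : ℕ}
    (π : (Fin m → ℝ) →ₗ[ℝ] (Fin r → ℝ)) (hπ : Function.Surjective π) :
    Measure.map π volume ≪ volume := by
  obtain ⟨c, -, h⟩ := π.exists_map_addHaar_eq_smul_addHaar volume volume hπ
  rw [h]
  exact Measure.smul_absolutelyContinuous

/-- An affine image of an absolutely continuous probability measure is the image of an absolutely
continuous probability measure under an injective affine map, from a space whose dimension is the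
rank of the linear part. -/
lemma AffineMap.exists_injective_map_eq {m n : ℕ} (h : (Fin m → ℝ) →ᵃ[ℝ] (Fin n → ℝ))
    (ν : Measure (Fin m → ℝ)) [IsProbabilityMeasure ν] (hν : ν ≪ volume) :
    ∃ (g : (Fin (Module.finrank ℝ (LinearMap.range h.linear)) → ℝ) →ᵃ[ℝ] (Fin n → ℝ))
      (ρ : Measure (Fin (Module.finrank ℝ (LinearMap.range h.linear)) → ℝ)),
        Function.Injective g ∧ IsProbabilityMeasure ρ ∧ ρ ≪ volume ∧
        Measure.map h ν = Measure.map g ρ := by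
  let e := (Module.finBasis ℝ (LinearMap.range h.linear)).equivFun
  let π := e.toLinearMap ∘ₗ h.linear.rangeRestrict
  let L := (LinearMap.range h.linear).subtype ∘ₗ e.symm.toLinearMap
  let g := L.toAffineMap + AffineMap.const ℝ _ (h 0)
  have hπ : Function.Surjective π := e.surjective.comp h.linear.surjective_rangeRestrict
  have hπm : Measurable π := π.continuous_of_finiteDimensional.measurable
  have hgm : Measurable g := g.continuous_of_finiteDimensional.measurable
  have hgπ : g ∘ π = h := by
    funext x
    simpa [g, L, π] using (congrFun h.decomp x).symm
  refine ⟨g, Measure.map π ν, ?_, Measure.isProbabilityMeasure_map hπm.aemeasurable,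
    (hν.map hπm).trans (π.absolutelyContinuous_map_volume_of_surjective hπ), ?_⟩
  · intro x y hxy
    have : L x = L y := by simpa [g] using hxy
    exact e.symm.injective (Subtype.val_injective this)
  · rw [Measure.map_map hgm hπm, hgπ]

/-- A linear image of an affinely singular random vector is affinely singular, and
the singular dimensions are the ranks of the compositions of the linear map with
the linear parts of the affine components. -/
theorem linear_image_affinelySingular {Ω : Type*} [MeasurableSpace Ω]
    (P : Measure Ω) [IsProbabilityMeasure P]
    (d : ℕ) (Z : Ω → Fin d → ℝ) (hZ : Measurable Z)
    (w : ℕ → ℝ≥0∞) (hw : ∑' i, w i = 1)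
    (dim : ℕ → ℕ) (f : ∀ i, (Fin (dim i) → ℝ) →ᵃ[ℝ] (Fin d → ℝ))
    (hf : ∀ i, Function.Injective (f i))
    (ν : ∀ i, Measure (Fin (dim i) → ℝ))
    (hνprob : ∀ i, IsProbabilityMeasure (ν i)) (hνac : ∀ i, ν i ≪ volume)
    (hlaw : Measure.map Z P = Measure.sum fun i => w i • Measure.map (f i) (ν i))
    (n : ℕ) (T : (Fin d → ℝ) →ₗ[ℝ] (Fin n → ℝ)) :
    ∃ (r : ℕ → ℕ) (g : ∀ i, (Fin (r i) → ℝ) →ᵃ[ℝ] (Fin n → ℝ))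
      (ρ : ∀ i, Measure (Fin (r i) → ℝ)),
        (∀ i, r i = Module.finrank ℝ (LinearMap.range (T.comp (f i).linear))) ∧
        (∀ i, Function.Injective (g i)) ∧
        (∀ i, IsProbabilityMeasure (ρ i)) ∧
        (∀ i, ρ i ≪ volume) ∧
        Measure.map (fun ω => T (Z ω)) P =
          Measure.sum fun i => w i • Measure.map (g i) (ρ i) := by
  choose g ρ hg hρ hρac hmap using fun i =>
    (T.toAffineMap.comp (f i)).exists_injective_map_eq (ν i) (hνac i)
  refine ⟨_, g, ρ, fun _ => rfl, hg, hρ, hρac, ?_⟩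
  have hT : Measurable T := T.continuous_of_finiteDimensional.measurable
  have hfm (i : ℕ) : Measurable (f i) := (f i).continuous_of_finiteDimensional.measurable
  calc Measure.map (fun ω => T (Z ω)) P = Measure.map T (Measure.map Z P) :=
        (Measure.map_map hT hZ).symm
    _ = Measure.sum fun i => w i • Measure.map T (Measure.map (f i) (ν i)) := by
        rw [hlaw, Measure.map_sum hT.aemeasurable]
        simp only [Measure.map_smul]
    _ = Measure.sum fun i => w i • Measure.map (g i) (ρ i) := by
        congr 1 with i : 1
        rw [← hmap i, Measure.map_map hT (hfm i)]
        rfl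
end

section
/- Let α ∈ [0,1] and let μ = (1-α)·μ_d + α·μ_c be a probability measure on ℝ, where μ_d is purely atomic and μ_c is absolutely continuous with respect to Lebesgue measure. Then for every r ≥ 1 the product measure μ^{⊗r} on ℝ^r is a countable mixture ∑_{j} w_j·(f_j)_*ν_j, where w_j ≥ 0 sum to 1, each ν_j is a probability measure on ℝ^{d_j} absolutely continuous with respect to Lebesgue measure (0 ≤ d_j ≤ r), and each f_j : ℝ^{d_j} → ℝ^r is an injective affine map of the form f_j(u) = U_j·(u; 0) + b_j with U_j a coordinate-permutation matrix and b_j a fixed vector; i.e., an i.i.d. discrete-continuous random vector is orthogonally (affinely) singular with axis-aligned singular components. -/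
open MeasureTheory
open scoped ENNReal

theorem ENNReal.prod_tsum_eq_tsum_prod {C : Type*} :
    ∀ (n : ℕ) (f : Fin n → C → ℝ≥0∞), ∏ i, ∑' c, f i c = ∑' k : Fin n → C, ∏ i, f i (k i)
  | 0, f => by simp
  | n + 1, f => by
    rw [← (Fin.consEquiv fun _ : Fin (n + 1) => C).tsum_eq, ENNReal.tsum_prod']
    simp only [Fin.prod_univ_succ, Fin.consEquiv_apply, Fin.cons_zero, Fin.cons_succ,
      ENNReal.tsum_mul_left, ENNReal.tsum_mul_right]
    rw [ENNReal.prod_tsum_eq_tsum_prod n]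

theorem ENNReal.tsum_option {C : Type*} (f : Option C → ℝ≥0∞) :
    ∑' c, f c = f none + ∑' c, f (some c) := by
  rw [← (Equiv.optionEquivSumPUnit.{0} C).symm.tsum_eq,
    Summable.tsum_sum ENNReal.summable ENNReal.summable, add_comm]
  simp

theorem MeasureTheory.Measure.pi_sum_smul {C X : Type*} [MeasurableSpace X] [Countable C]
    {n : ℕ} (p : C → ℝ≥0∞) (m : C → Measure X) [∀ c, SigmaFinite (m c)]
    [SigmaFinite (Measure.sum fun c => p c • m c)] :
    Measure.pi (fun _ : Fin n => Measure.sum fun c => p c • m c) =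
      Measure.sum fun k : Fin n → C => (∏ i, p (k i)) • Measure.pi fun i => m (k i) := by
  refine Measure.pi_eq fun t ht => ?_
  rw [Measure.sum_apply _ (MeasurableSet.univ_pi ht)]
  simp only [Measure.sum_apply _ (ht _), Measure.smul_apply, Measure.pi_pi, smul_eq_mul,
    ENNReal.prod_tsum_eq_tsum_prod, Finset.prod_mul_distrib]

theorem MeasureTheory.Measure.AbsolutelyContinuous.pi_fin {X : Type*} [MeasurableSpace X]
    {μ ν : Measure X} [SigmaFinite μ] [SigmaFinite ν] (h : μ ≪ ν) :
    ∀ n : ℕ, Measure.pi (fun _ : Fin n => μ) ≪ Measure.pi (fun _ : Fin n => ν)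
  | 0 => by
    rw [Measure.pi_of_empty, Measure.pi_of_empty]
  | n + 1 => by
    have hμ := (measurePreserving_piFinSuccAbove (fun _ : Fin (n + 1) => μ) 0).symm
    have hν := (measurePreserving_piFinSuccAbove (fun _ : Fin (n + 1) => ν) 0).symm
    rw [← hμ.map_eq, ← hν.map_eq]
    exact (h.prod (pi_fin h n)).map hν.measurable

theorem MeasureTheory.Measure.eq_sum_smul_dirac_of_compl_null {X : Type*} [MeasurableSpace X]
    [MeasurableSingletonClass X] (μ : Measure X) {s : Set X} (hs : s.Countable)
    (h : μ sᶜ = 0) :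
    μ = Measure.sum fun x : s => μ {(x : X)} • Measure.dirac (x : X) := by
  have := hs.to_subtype
  have hU : (⋃ x : s, {(x : X)}) = s := by ext; simp
  conv_lhs => rw [← Measure.restrict_eq_self_of_ae_mem (s := s) (μ := μ) (mem_ae_iff.2 h), ← hU]
  rw [Measure.restrict_iUnion]
  · simp only [Measure.restrict_singleton]
  · intro x y hxy
    simpa [Function.onFun, Subtype.ext_iff] using hxy
  · exact fun x => measurableSet_singleton _

/-- A product of copies of a measure `μ` and of Dirac masses is the pushforward of a power of `μ`
under a coordinate embedding followed by a translation. -/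
theorem pi_eq_map_of_dirac {r : ℕ} (μ : Measure ℝ) [IsProbabilityMeasure μ]
    (m : Fin r → Measure ℝ) [∀ i, IsProbabilityMeasure (m i)] (b : Fin r → ℝ)
    (P : Fin r → Prop) (hP : ∀ i, P i → m i = μ ∧ b i = 0)
    (hnP : ∀ i, ¬ P i → m i = Measure.dirac (b i)) :
    ∃ d ≤ r, ∃ σ : Equiv.Perm (Fin r),
      Measure.pi m = Measure.map (fun (u : Fin d → ℝ) (i : Fin r) =>
        (if h : ((σ i : ℕ)) < d then u ⟨σ i, h⟩ else 0) + b i)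
        (Measure.pi fun _ => μ) := by
  classical
  have hd : Fintype.card {i // P i} ≤ r := by
    simpa using Fintype.card_subtype_le P
  refine ⟨Fintype.card {i // P i}, hd, ?_⟩
  set d := Fintype.card {i // P i}
  let e : {i // P i} ≃ {j : Fin r // (j : ℕ) < d} :=
    (Fintype.equivFin {i // P i}).trans (Fin.castLEquiv hd)
  let σ : Equiv.Perm (Fin r) := e.extendSubtype
  have hσ : ∀ i, (σ i : ℕ) < d ↔ P i := fun i =>
    ⟨fun h => by_contra fun hi => e.extendSubtype_not_mem i hi h, e.extendSubtype_mem i⟩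
  have hmeas : Measurable (fun (u : Fin d → ℝ) (i : Fin r) =>
      (if h : ((σ i : ℕ)) < d then u ⟨σ i, h⟩ else 0) + b i) := by
    refine measurable_pi_lambda _ fun i => ?_
    by_cases h : (σ i : ℕ) < d
    · simp only [h, dite_true]; fun_prop
    · simp only [h, dite_false]; fun_prop
  refine ⟨σ, Measure.pi_eq fun t ht => ?_⟩
  rw [Measure.map_apply hmeas (MeasurableSet.univ_pi ht)]
  let E : {i // P i} ≃ Fin d := Fintype.equivFin {i // P i}
  have hσE : ∀ j, σ (E.symm j : Fin r) = Fin.castLE hd j := fun j => by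
    rw [show σ (E.symm j : Fin r) = e ⟨_, (E.symm j).2⟩ from
      e.extendSubtype_apply_of_mem _ (E.symm j).2]
    simp [e, E, Fin.castLEquiv]
  by_cases hb : ∀ i, ¬ P i → b i ∈ t i
  · have hpre : (fun (u : Fin d → ℝ) (i : Fin r) =>
        (if h : ((σ i : ℕ)) < d then u ⟨σ i, h⟩ else 0) + b i) ⁻¹' Set.univ.pi t =
        Set.univ.pi fun j : Fin d => t (E.symm j) := by
      ext u
      simp only [Set.mem_preimage, Set.mem_univ_pi]
      constructor
      · intro h j
        have := h (E.symm j)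
        simpa [hσE, (hP _ (E.symm j).2).2] using this
      · intro h i
        by_cases hi : P i
        · have h1 := h (E ⟨i, hi⟩)
          have h2 := hσE (E ⟨i, hi⟩)
          rw [E.symm_apply_apply] at h1 h2
          have h3 : (⟨σ i, (hσ i).2 hi⟩ : Fin d) = E ⟨i, hi⟩ := by
            apply Fin.ext; simpa using congrArg Fin.val h2
          rw [dif_pos ((hσ i).2 hi), h3, (hP i hi).2, add_zero]
          exact h1
        · rw [dif_neg (fun h => hi ((hσ i).1 h)), zero_add]
          exact hb i hi
    rw [hpre, Measure.pi_pi, ← Fintype.prod_subtype_mul_prod_subtype P fun i => m i (t i)]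
    have h1 : ∏ i : {i // ¬ P i}, m i (t i) = 1 :=
      Finset.prod_eq_one fun i _ => by
        rw [hnP i i.2, Measure.dirac_apply_of_mem (hb i i.2)]
    rw [h1, mul_one]
    exact Fintype.prod_equiv E.symm _ _ fun j => by rw [(hP _ (E.symm j).2).1]
  · push Not at hb
    obtain ⟨i, hi, hbi⟩ := hb
    have hpre : (fun (u : Fin d → ℝ) (i : Fin r) =>
        (if h : ((σ i : ℕ)) < d then u ⟨σ i, h⟩ else 0) + b i) ⁻¹' Set.univ.pi t = ∅ := by
      ext u
      simp only [Set.mem_preimage, Set.mem_univ_pi, Set.mem_empty_iff_false, iff_false]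
      intro h
      have := h i
      rw [dif_neg (fun h => hi ((hσ i).1 h)), zero_add] at this
      exact hbi this
    rw [hpre, measure_empty, Finset.prod_eq_zero (Finset.mem_univ i)]
    rw [hnP i hi, Measure.dirac_apply' _ (ht i), Set.indicator_of_notMem hbi]

/-- An i.i.d. vector of `r` discrete-continuous real random variables is
orthogonally (affinely) singular: its law `μ^{⊗ r}` is a countable mixture of
pushforwards of Lebesgue-absolutely-continuous probability measures under the
injective affine maps `u ↦ U (u ; 0) + b` with `U` a coordinate permutation. -/
theorem pi_discreteContinuous_orthogonallySingular
    (α : ℝ) (hα : α ∈ Set.Icc (0 : ℝ) 1)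
    (μ μd μc : Measure ℝ) [IsProbabilityMeasure μd] [IsProbabilityMeasure μc]
    (hatomic : ∃ s : Set ℝ, s.Countable ∧ μd sᶜ = 0)
    (hac : μc ≪ volume)
    (hμ : μ = ENNReal.ofReal (1 - α) • μd + ENNReal.ofReal α • μc)
    (r : ℕ) (hr : 1 ≤ r) :
    ∃ (w : ℕ → ℝ≥0∞) (dim : ℕ → ℕ) (σ : ℕ → Equiv.Perm (Fin r))
      (b : ℕ → Fin r → ℝ) (ν : ∀ j, Measure (Fin (dim j) → ℝ)),
        (∑' j, w j = 1) ∧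
        (∀ j, dim j ≤ r) ∧
        (∀ j, IsProbabilityMeasure (ν j)) ∧
        (∀ j, ν j ≪ volume) ∧
        Measure.pi (fun _ : Fin r => μ) =
          Measure.sum fun j =>
            w j • Measure.map
              (fun (u : Fin (dim j) → ℝ) (i : Fin r) =>
                (if h : ((σ j i : ℕ)) < dim j then u ⟨σ j i, h⟩ else 0) + b j i)
              (ν j) := by
  classical
  obtain ⟨s, hs, hs0⟩ := hatomic
  have := hs.to_subtype
  let p : Option s → ℝ≥0∞ := fun c =>
    c.elim (ENNReal.ofReal α) fun x => ENNReal.ofReal (1 - α) * μd {(x : ℝ)}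
  let m : Option s → Measure ℝ := fun c => c.elim μc fun x => Measure.dirac (x : ℝ)
  let a : Option s → ℝ := fun c => c.elim 0 fun x => (x : ℝ)
  have hm : ∀ c, IsProbabilityMeasure (m c) := by
    rintro (_ | x)
    · exact ‹IsProbabilityMeasure μc›
    · exact Measure.dirac.isProbabilityMeasure
  have hμ1 : IsProbabilityMeasure μ := ⟨by
    rw [hμ]
    simp only [Measure.add_apply, Measure.smul_apply, measure_univ, smul_eq_mul, mul_one]
    rw [← ENNReal.ofReal_add (by linarith [hα.2]) hα.1]
    simp⟩
  have hμsum : μ = Measure.sum fun c => p c • m c := by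
    rw [hμ, Measure.eq_sum_smul_dirac_of_compl_null μd hs hs0]
    ext A hA
    rw [Measure.sum_apply _ hA, ENNReal.tsum_option]
    simp only [Measure.add_apply, Measure.smul_apply, Measure.sum_apply _ hA, smul_eq_mul]
    simp only [p, m, Option.elim, mul_assoc, ENNReal.tsum_mul_left]
    rw [add_comm]
  have hsf : SigmaFinite (Measure.sum fun c => p c • m c) := hμsum ▸ inferInstance
  have hpi : Measure.pi (fun _ : Fin r => μ) = Measure.sum fun k : Fin r → Option s =>
      (∏ i, p (k i)) • Measure.pi fun i => m (k i) := by
    simp only [hμsum]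
    exact Measure.pi_sum_smul p m
  have hcomp : ∀ k : Fin r → Option s, ∃ d ≤ r, ∃ σ : Equiv.Perm (Fin r),
      Measure.pi (fun i => m (k i)) = Measure.map (fun (u : Fin d → ℝ) (i : Fin r) =>
        (if h : ((σ i : ℕ)) < d then u ⟨σ i, h⟩ else 0) + a (k i))
        (Measure.pi fun _ => μc) := fun k => by
    refine pi_eq_map_of_dirac μc (fun i => m (k i)) (fun i => a (k i)) (fun i => k i = none) ?_ ?_
    · intro i hi
      simp [hi, m, a]
    · intro i hi
      obtain ⟨x, hx⟩ := Option.ne_none_iff_exists'.1 hi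
      simp [hx, m, a]
  choose d hd σ hdσ using hcomp
  obtain ⟨e, he⟩ := exists_injective_nat (Fin r → Option s)
  let w : ℕ → ℝ≥0∞ := Function.extend e (fun k => ∏ i, p (k i)) 0
  have hw : ∀ k, w (e k) = ∏ i, p (k i) := fun k => he.extend_apply _ _ k
  have hw0 : Function.support w ⊆ Set.range e := fun n hn => by
    by_contra h
    exact hn (Function.extend_apply' _ _ n h)
  let g : ℕ → Fin r → Option s := Function.invFun e
  have hg : ∀ k, g (e k) = k := Function.leftInverse_invFun he
  refine ⟨w, fun n => d (g n), fun n => σ (g n), fun n i => a (g n i),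
    fun n => Measure.pi fun _ => μc, ?_, fun n => hd _, fun n => inferInstance,
    fun n => hac.pi_fin _, ?_⟩
  · rw [← he.tsum_eq hw0]
    have := congrArg (fun ρ => ρ Set.univ) hpi
    simpa [Measure.sum_apply, hw] using this.symm
  · simp only [← hdσ]
    rw [hpi]
    ext A hA
    rw [Measure.sum_apply _ hA, Measure.sum_apply _ hA, ← he.tsum_eq]
    · simp only [Measure.smul_apply, hw, hg]
    · refine Set.Subset.trans (fun n hn => ?_) hw0
      contrapose! hn
      simp_all
end
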